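/- Let ρ, c > 0 and define the 2×2 real matrices A = [[0, ρc²],[ρ⁻¹, 0]], S = diag(ρ⁻¹c⁻², ρ), P = (1/√(2ρ)) · [[−cρ, cρ],[1, 1]], A⁺ = P·diag(0, c)·P⁻¹, A⁻ = P·diag(−c, 0)·P⁻¹, and |A| = P·diag(c, c)·P⁻¹. Then: (i) S = P⁻ᵀ P⁻¹ and A = P·diag(−c, c)·P⁻¹; (ii) S·A⁺, S·A⁻, and S·|A| are symmetric, with S·A⁺ positive semi-definite, S·A⁻ negative semi-definite, and S·|A| positive definite; (iii) for every w ∈ ℝ², if ‖A⁺w‖² + |wᵀ S A⁻ w| = 0 then w = 0, and likewise if ‖A⁻w‖² + |wᵀ S A⁺ w| = 0 then w = 0; (iv) wᵀ S A⁺ w − wᵀ S A⁻ w ≥ min(ρc, ρ⁻¹c⁻¹) · ‖w‖² for all w ∈ ℝ², where ‖·‖ is the Euclidean norm. -/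

import Mathlib

open Matrix

noncomputable section

/-- The acoustic flux matrix `A = [[0, ρc²], [ρ⁻¹, 0]]`. -/
def acousticA (ρ c : ℝ) : Matrix (Fin 2) (Fin 2) ℝ := !![0, ρ * c ^ 2; ρ⁻¹, 0]

/-- The symmetrizer `S = diag(ρ⁻¹ c⁻², ρ)`. -/
def acousticS (ρ c : ℝ) : Matrix (Fin 2) (Fin 2) ℝ :=
  Matrix.diagonal ![ρ⁻¹ * (c ^ 2)⁻¹, ρ]

/-- The eigenvector matrix `P = (1/√(2ρ)) [[-cρ, cρ], [1, 1]]`. -/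
def acousticP (ρ c : ℝ) : Matrix (Fin 2) (Fin 2) ℝ :=
  (Real.sqrt (2 * ρ))⁻¹ • !![-(c * ρ), c * ρ; 1, 1]

/-- The positive part `A⁺ = P diag(0, c) P⁻¹`. -/
def acousticAp (ρ c : ℝ) : Matrix (Fin 2) (Fin 2) ℝ :=
  acousticP ρ c * Matrix.diagonal ![0, c] * (acousticP ρ c)⁻¹

/-- The negative part `A⁻ = P diag(-c, 0) P⁻¹`. -/
def acousticAm (ρ c : ℝ) : Matrix (Fin 2) (Fin 2) ℝ :=
  acousticP ρ c * Matrix.diagonal ![-c, 0] * (acousticP ρ c)⁻¹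

/-- The absolute value `|A| = P diag(c, c) P⁻¹`. -/
def acousticAbs (ρ c : ℝ) : Matrix (Fin 2) (Fin 2) ℝ :=
  acousticP ρ c * Matrix.diagonal ![c, c] * (acousticP ρ c)⁻¹

theorem acousticP_inv {ρ c : ℝ} (hρ : 0 < ρ) (hc : 0 < c) :
    (acousticP ρ c)⁻¹ =
      (Real.sqrt (2 * ρ) / (2 * c * ρ)) • !![-1, c * ρ; 1, c * ρ] := by
  have hs : Real.sqrt (2 * ρ) ≠ 0 := (Real.sqrt_pos.2 (by positivity)).ne'
  apply Matrix.inv_eq_right_inv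
  ext i j
  fin_cases i <;> fin_cases j <;>
    simp [acousticP, Matrix.mul_apply, Fin.sum_univ_two] <;> field_simp <;> norm_num

theorem acousticP_conj_diagonal {ρ c : ℝ} (hρ : 0 < ρ) (hc : 0 < c) (a b : ℝ) :
    acousticP ρ c * Matrix.diagonal ![a, b] * (acousticP ρ c)⁻¹ =
      !![(a + b) / 2, c * ρ * (b - a) / 2; (b - a) / (2 * c * ρ), (a + b) / 2] := by
  have hs : Real.sqrt (2 * ρ) ≠ 0 := (Real.sqrt_pos.2 (by positivity)).ne'
  rw [acousticP_inv hρ hc, acousticP]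
  generalize Real.sqrt (2 * ρ) = s at hs
  ext i j
  fin_cases i <;> fin_cases j <;>
    simp [Matrix.mul_apply, Fin.sum_univ_two, Matrix.vecMul_diagonal] <;> field_simp <;> ring

theorem acousticS_eq {ρ c : ℝ} (hρ : 0 < ρ) (hc : 0 < c) :
    acousticS ρ c = ((acousticP ρ c)⁻¹)ᵀ * (acousticP ρ c)⁻¹ := by
  have hs : Real.sqrt (2 * ρ) ^ 2 = 2 * ρ := Real.sq_sqrt (by positivity)
  rw [acousticP_inv hρ hc]
  generalize Real.sqrt (2 * ρ) = s at hs
  ext i j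
  fin_cases i <;> fin_cases j <;>
    simp [acousticS, Matrix.mul_apply, Fin.sum_univ_two] <;> field_simp <;> rw [hs] <;> ring

theorem acousticAp_eq {ρ c : ℝ} (hρ : 0 < ρ) (hc : 0 < c) :
    acousticAp ρ c = !![c / 2, c ^ 2 * ρ / 2; 1 / (2 * ρ), c / 2] := by
  rw [acousticAp, acousticP_conj_diagonal hρ hc]
  ext i j
  fin_cases i <;> fin_cases j <;> simp <;> field_simp

theorem acousticAm_eq {ρ c : ℝ} (hρ : 0 < ρ) (hc : 0 < c) :
    acousticAm ρ c = !![-(c / 2), c ^ 2 * ρ / 2; 1 / (2 * ρ), -(c / 2)] := by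
  rw [acousticAm, acousticP_conj_diagonal hρ hc]
  ext i j
  fin_cases i <;> fin_cases j <;> simp <;> field_simp

theorem acousticS_mul_acousticAp {ρ c : ℝ} (hρ : 0 < ρ) (hc : 0 < c) :
    acousticS ρ c * acousticAp ρ c = !![1 / (2 * c * ρ), 1 / 2; 1 / 2, c * ρ / 2] := by
  rw [acousticAp_eq hρ hc, acousticS]
  ext i j
  fin_cases i <;> fin_cases j <;> simp <;> field_simp

theorem acousticS_mul_acousticAm {ρ c : ℝ} (hρ : 0 < ρ) (hc : 0 < c) :
    acousticS ρ c * acousticAm ρ c = !![-(1 / (2 * c * ρ)), 1 / 2; 1 / 2, -(c * ρ / 2)] := by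
  rw [acousticAm_eq hρ hc, acousticS]
  ext i j
  fin_cases i <;> fin_cases j <;> simp <;> field_simp

theorem acousticS_mul_acousticAbs {ρ c : ℝ} (hρ : 0 < ρ) (hc : 0 < c) :
    acousticS ρ c * acousticAbs ρ c = Matrix.diagonal ![1 / (c * ρ), c * ρ] := by
  rw [acousticAbs, acousticP_conj_diagonal hρ hc, acousticS]
  ext i j
  fin_cases i <;> fin_cases j <;> simp <;> field_simp

theorem dotProduct_acousticS_mul_acousticAp {ρ c : ℝ} (hρ : 0 < ρ) (hc : 0 < c)
    (w : Fin 2 → ℝ) :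
    w ⬝ᵥ (acousticS ρ c * acousticAp ρ c).mulVec w =
      (w 0 + c * ρ * w 1) ^ 2 / (2 * c * ρ) := by
  rw [acousticS_mul_acousticAp hρ hc]
  simp [dotProduct, Matrix.mulVec, Fin.sum_univ_two]
  field_simp

theorem dotProduct_acousticS_mul_acousticAm {ρ c : ℝ} (hρ : 0 < ρ) (hc : 0 < c)
    (w : Fin 2 → ℝ) :
    w ⬝ᵥ (acousticS ρ c * acousticAm ρ c).mulVec w =
      -((w 0 - c * ρ * w 1) ^ 2 / (2 * c * ρ)) := by
  rw [acousticS_mul_acousticAm hρ hc]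
  simp [dotProduct, Matrix.mulVec, Fin.sum_univ_two]
  field_simp
  ring

theorem acousticAp_mulVec_one {ρ c : ℝ} (hρ : 0 < ρ) (hc : 0 < c) (w : Fin 2 → ℝ) :
    (acousticAp ρ c).mulVec w 1 = (w 0 + c * ρ * w 1) / (2 * ρ) := by
  rw [acousticAp_eq hρ hc]
  simp [Matrix.mulVec, dotProduct, Fin.sum_univ_two]
  field_simp

theorem acousticAm_mulVec_one {ρ c : ℝ} (hρ : 0 < ρ) (hc : 0 < c) (w : Fin 2 → ℝ) :
    (acousticAm ρ c).mulVec w 1 = (w 0 - c * ρ * w 1) / (2 * ρ) := by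
  rw [acousticAm_eq hρ hc]
  simp [Matrix.mulVec, dotProduct, Fin.sum_univ_two]
  field_simp
  ring

theorem eq_zero_of_add_sub_eq_zero {k : ℝ} (hk : k ≠ 0) {w : Fin 2 → ℝ}
    (hadd : w 0 + k * w 1 = 0) (hsub : w 0 - k * w 1 = 0) : w = 0 := by
  have h0 : w 0 = 0 := by linarith
  have h1 : w 1 = 0 := (mul_eq_zero.1 (by linarith : k * w 1 = 0)).resolve_left hk
  ext i
  fin_cases i
  · exact h0
  · exact h1

/-- Properties of the matrices of the acoustic system: (i) the
eigen-decomposition `A = P diag(-c, c) P⁻¹` and `S = P⁻ᵀ P⁻¹`; (ii) `S A⁺`, `S A⁻` and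
`S |A|` are symmetric, with `S A⁺` positive semi-definite, `S A⁻` negative semi-definite
and `S |A|` positive definite; (iii) `‖A⁺ w‖² + |wᵀ S A⁻ w| = 0` implies `w = 0`, and
likewise with the roles of `+` and `-` exchanged; (iv) the coercivity bound
`wᵀ S A⁺ w - wᵀ S A⁻ w ≥ min(ρc, ρ⁻¹c⁻¹) ‖w‖²`. -/
theorem stmt15 (ρ c : ℝ) (hρ : 0 < ρ) (hc : 0 < c) :
    (acousticS ρ c = ((acousticP ρ c)⁻¹)ᵀ * (acousticP ρ c)⁻¹ ∧
      acousticA ρ c = acousticP ρ c * Matrix.diagonal ![-c, c] * (acousticP ρ c)⁻¹) ∧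
    ((acousticS ρ c * acousticAp ρ c).IsSymm ∧
      (acousticS ρ c * acousticAm ρ c).IsSymm ∧
      (acousticS ρ c * acousticAbs ρ c).IsSymm ∧
      (acousticS ρ c * acousticAp ρ c).PosSemidef ∧
      (-(acousticS ρ c * acousticAm ρ c)).PosSemidef ∧
      (acousticS ρ c * acousticAbs ρ c).PosDef) ∧
    (∀ w : Fin 2 → ℝ,
        (((acousticAp ρ c).mulVec w 0) ^ 2 + ((acousticAp ρ c).mulVec w 1) ^ 2) +
            |w ⬝ᵥ (acousticS ρ c * acousticAm ρ c).mulVec w| = 0 → w = 0) ∧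
    (∀ w : Fin 2 → ℝ,
        (((acousticAm ρ c).mulVec w 0) ^ 2 + ((acousticAm ρ c).mulVec w 1) ^ 2) +
            |w ⬝ᵥ (acousticS ρ c * acousticAp ρ c).mulVec w| = 0 → w = 0) ∧
    (∀ w : Fin 2 → ℝ,
        min (ρ * c) (ρ⁻¹ * c⁻¹) * ((w 0) ^ 2 + (w 1) ^ 2) ≤
          w ⬝ᵥ (acousticS ρ c * acousticAp ρ c).mulVec w -
            w ⬝ᵥ (acousticS ρ c * acousticAm ρ c).mulVec w) := by
  have hk : c * ρ ≠ 0 := by positivity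
  have isSymm_p : (acousticS ρ c * acousticAp ρ c).IsSymm := by
    rw [acousticS_mul_acousticAp hρ hc]
    ext i j
    fin_cases i <;> fin_cases j <;> rfl
  have isSymm_m : (acousticS ρ c * acousticAm ρ c).IsSymm := by
    rw [acousticS_mul_acousticAm hρ hc]
    ext i j
    fin_cases i <;> fin_cases j <;> rfl
  refine ⟨⟨acousticS_eq hρ hc, ?_⟩, ⟨isSymm_p, isSymm_m, ?_, ?_, ?_, ?_⟩, fun w h => ?_,
    fun w h => ?_, fun w => ?_⟩
  · rw [acousticP_conj_diagonal hρ hc, acousticA]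
    ext i j
    fin_cases i <;> fin_cases j <;> simp <;> field_simp <;> norm_num
  · rw [acousticS_mul_acousticAbs hρ hc]
    exact Matrix.isSymm_diagonal _
  · refine Matrix.PosSemidef.of_dotProduct_mulVec_nonneg
      (Matrix.conjTranspose_eq_transpose_of_trivial _ |>.trans isSymm_p) fun w => ?_
    rw [star_trivial, dotProduct_acousticS_mul_acousticAp hρ hc]
    positivity
  · refine Matrix.PosSemidef.of_dotProduct_mulVec_nonneg
      (Matrix.conjTranspose_eq_transpose_of_trivial _ |>.trans isSymm_m.neg) fun w => ?_
    rw [star_trivial, Matrix.neg_mulVec, dotProduct_neg,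
      dotProduct_acousticS_mul_acousticAm hρ hc, neg_neg]
    positivity
  · rw [acousticS_mul_acousticAbs hρ hc]
    refine Matrix.PosDef.diagonal fun i => ?_
    fin_cases i <;> simp <;> positivity
  · rw [dotProduct_acousticS_mul_acousticAm hρ hc, acousticAp_mulVec_one hρ hc] at h
    obtain ⟨hA, hS⟩ := (add_eq_zero_iff_of_nonneg (by positivity) (by positivity)).1 h
    have hA1 := ((add_eq_zero_iff_of_nonneg (by positivity) (by positivity)).1 hA).2
    refine eq_zero_of_add_sub_eq_zero hk ?_ ?_
    · simpa [hρ.ne'] using hA1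
    · simpa [hρ.ne', hc.ne'] using hS
  · rw [dotProduct_acousticS_mul_acousticAp hρ hc, acousticAm_mulVec_one hρ hc] at h
    obtain ⟨hA, hS⟩ := (add_eq_zero_iff_of_nonneg (by positivity) (by positivity)).1 h
    have hA1 := ((add_eq_zero_iff_of_nonneg (by positivity) (by positivity)).1 hA).2
    refine eq_zero_of_add_sub_eq_zero hk ?_ ?_
    · simpa [hρ.ne', hc.ne'] using hS
    · simpa [hρ.ne'] using hA1
  · rw [dotProduct_acousticS_mul_acousticAp hρ hc, dotProduct_acousticS_mul_acousticAm hρ hc]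
    calc min (ρ * c) (ρ⁻¹ * c⁻¹) * (w 0 ^ 2 + w 1 ^ 2)
        = min (ρ * c) (ρ⁻¹ * c⁻¹) * w 0 ^ 2 + min (ρ * c) (ρ⁻¹ * c⁻¹) * w 1 ^ 2 := mul_add ..
      _ ≤ ρ⁻¹ * c⁻¹ * w 0 ^ 2 + ρ * c * w 1 ^ 2 := by
        gcongr
        · exact min_le_right _ _
        · exact min_le_left _ _
      _ = _ := by
        field_simp
        ring

end
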